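/- Suppose X and Y are sequences such that Y is a nonempty proper suffix of X, CN(YX) = 1, and CN(XYX) > 1. Then there exist sequences S and T such that YX = STS, T is a suffix of X, T is a proper suffix of S, and CN(S) = 1. Furthermore, either |S| = |Y| or |S| > 2|Y|. -/

import Mathlib

/-- `listPow Y k` is the sequence `Y` repeated `k` times (i.e. `Y^k`). -/
def listPow {α : Type*} (Y : List α) : ℕ → List α
  | 0 => []
  | k + 1 => Y ++ listPow Y k

/-- The curling number of a finite sequence `S`: the largest `k` such that
`S = X ++ Y^k` for some (possibly empty) `X` and nonempty `Y`. -/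
noncomputable def CN {α : Type*} (S : List α) : ℕ :=
  sSup {k | ∃ X Y : List α, Y ≠ [] ∧ S = X ++ listPow Y k}

/-- A nonempty sequence is primitive if it is not a power `T^i` with `i ≥ 2`. -/
def Primitive {α : Type*} (S : List α) : Prop :=
  S ≠ [] ∧ ∀ (T : List α) (i : ℕ), 2 ≤ i → S ≠ listPow T i

/-- `T` is a proper suffix of `S`: a suffix which is strictly shorter than `S`. -/
def ProperSuffix {α : Type*} (T S : List α) : Prop := T <:+ S ∧ T.length < S.length

/-- A sequence `S` with curling number `k` is robust if no proper suffix of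
`S^(k+1)` has curling number `≥ k + 1`. -/
def Robust {α : Type*} (S : List α) : Prop :=
  ∀ T : List α, ProperSuffix T (listPow S (CN S + 1)) → CN T ≤ CN S

theorem length_listPow {α : Type*} (Y : List α) (k : ℕ) :
    (listPow Y k).length = k * Y.length := by
  induction k with
  | zero => simp [listPow]
  | succ k ih => simp [listPow, ih, Nat.succ_mul, Nat.add_comm]

theorem listPow_append_self {α : Type*} (Y : List α) (k : ℕ) :
    listPow Y k ++ Y = listPow Y (k + 1) := by
  induction k with
  | zero => simp [listPow]
  | succ k ih => rw [listPow, List.append_assoc, ih]; rfl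

theorem bddAbove_curling {α : Type*} (S : List α) :
    BddAbove {k | ∃ X Y : List α, Y ≠ [] ∧ S = X ++ listPow Y k} := by
  refine ⟨S.length, ?_⟩
  rintro k ⟨X, Y, hY, rfl⟩
  have hpos := List.length_pos_of_ne_nil hY
  rw [List.length_append, length_listPow]
  nlinarith

theorem one_le_CN {α : Type*} {S : List α} (hS : S ≠ []) : 1 ≤ CN S :=
  le_csSup (bddAbove_curling S) ⟨[], S, hS, by simp [listPow]⟩

/-- The curling number exceeds `1` exactly when some suffix is a nonempty square. -/
theorem one_lt_CN_iff {α : Type*} {S : List α} :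
    1 < CN S ↔ ∃ B : List α, B ≠ [] ∧ B ++ B <:+ S := by
  constructor
  · intro h
    have hne : {k | ∃ X Y : List α, Y ≠ [] ∧ S = X ++ listPow Y k}.Nonempty := by
      by_contra hempty
      rw [Set.not_nonempty_iff_eq_empty] at hempty
      simp [CN, hempty] at h
    obtain ⟨X, Y, hY, hS⟩ := Nat.sSup_mem hne (bddAbove_curling S)
    change S = X ++ listPow Y (CN S) at hS
    obtain ⟨j, hj⟩ := Nat.exists_eq_add_of_le' h
    rw [hj] at hS
    refine ⟨Y, hY, X ++ listPow Y j, ?_⟩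
    rw [hS, ← listPow_append_self, ← listPow_append_self]
    simp
  · rintro ⟨B, hB, A, hS⟩
    exact le_csSup (bddAbove_curling S) ⟨A, B, hB, by simp [listPow, ← hS]⟩

/-- A list with a proper border of at least half its length ends in a nonempty square. -/
theorem exists_square_suffix_of_border {α : Type*} {A B : List α} (hp : A <+: B) (hs : A <:+ B)
    (hlt : A.length < B.length) (hle : B.length ≤ 2 * A.length) :
    ∃ C : List α, C ≠ [] ∧ C ++ C <:+ B := by
  obtain ⟨C, rfl⟩ := hp
  rw [List.length_append] at hlt hle
  obtain ⟨E, rfl⟩ : C <:+ A :=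
    List.suffix_of_suffix_length_le (List.suffix_append A C) hs (by omega)
  refine ⟨C, ?_, E, by simp⟩
  rintro rfl
  simp at hlt

/-- If `Y` is a nonempty proper suffix of `X`, `CN (Y X) = 1` and `CN (X Y X) > 1`, then
`Y X = S T S` with `T` a suffix of `X`, `T` a proper suffix of `S`, `CN S = 1`, and
either `|S| = |Y|` or `|S| > 2 |Y|`. -/
theorem thA5 {α : Type*} (X Y : List α) (hY : Y ≠ []) (hYX : ProperSuffix Y X)
    (h1 : CN (Y ++ X) = 1) (h2 : 1 < CN (X ++ Y ++ X)) :
    ∃ S T : List α, Y ++ X = S ++ T ++ S ∧ T <:+ X ∧ ProperSuffix T S ∧ CN S = 1 ∧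
      (S.length = Y.length ∨ 2 * Y.length < S.length) := by
  have hsq : ∀ B : List α, B ≠ [] → ¬ B ++ B <:+ Y ++ X := fun B hB hBs =>
    absurd (one_lt_CN_iff.2 ⟨B, hB, hBs⟩) (by omega)
  obtain ⟨hYs, hYlt⟩ := hYX
  have hYpos := List.length_pos_of_ne_nil hY
  obtain ⟨U, hU, P, hP⟩ := one_lt_CN_iff.1 h2
  have hlen := congrArg List.length hP
  simp only [List.length_append] at hlen
  have hUs : U <:+ X ++ (Y ++ X) := ⟨P ++ U, by simpa using hP⟩
  have hYXs : Y ++ X <:+ X ++ (Y ++ X) := List.suffix_append _ _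
  have hlong : Y.length + X.length < 2 * U.length := by
    by_contra! hle
    refine hsq U hU (List.suffix_of_suffix_length_le ⟨P, by simpa using hP⟩ hYXs ?_)
    simp only [List.length_append]
    omega
  obtain ⟨S, hS⟩ : U <:+ Y ++ X := List.suffix_of_suffix_length_le hUs hYXs (by
    simp only [List.length_append]
    omega)
  have hSlen := congrArg List.length hS
  simp only [List.length_append] at hSlen
  have hXS : X ++ S = P ++ U := by
    apply List.append_cancel_right (bs := U)
    rw [List.append_assoc, hS]
    simpa using hP.symm
  obtain ⟨T, rfl⟩ : S <:+ U := List.suffix_of_suffix_length_le (List.suffix_append X S)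
    (hXS ▸ List.suffix_append P U) (by omega)
  have hX : X = P ++ T := List.append_cancel_right (by simpa using hXS)
  have hTX : T <:+ X := ⟨P, hX.symm⟩
  have hSYX : S <:+ Y ++ X := ⟨S ++ T, by simpa using hS⟩
  simp only [List.length_append] at hlen hlong hSlen
  have hSX : S <:+ X :=
    List.suffix_of_suffix_length_le hSYX (List.suffix_append Y X) (by omega)
  have hSne : S ≠ [] := by
    rintro rfl
    simp only [List.length_nil] at hlen hlong hSlen
    omega
  have hTlt : T.length < S.length := by
    by_contra! hle
    obtain ⟨E, hE⟩ := List.suffix_of_suffix_length_le hSX hTX hle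
    exact hsq S hSne ⟨S ++ E, by rw [← hS, ← hE]; simp⟩
  have hSp : S <+: Y ++ X := ⟨T ++ S, hS⟩
  have hYp : Y <+: Y ++ X := List.prefix_append Y X
  refine ⟨S, T, by rw [← hS]; simp, hTX,
    ⟨List.suffix_of_suffix_length_le hTX hSX hTlt.le, hTlt⟩, ?_, ?_⟩
  · refine le_antisymm ?_ (one_le_CN hSne)
    by_contra! hlt
    obtain ⟨B, hB, hBs⟩ := one_lt_CN_iff.1 hlt
    exact hsq B hB (hBs.trans hSYX)
  · by_contra! hne
    rcases lt_or_gt_of_ne hne.1 with hlt | hlt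
    · obtain ⟨C, hC, hCs⟩ := exists_square_suffix_of_border
        (List.prefix_of_prefix_length_le hSp hYp hlt.le)
        (List.suffix_of_suffix_length_le hSX hYs hlt.le) hlt (by omega)
      exact hsq C hC (hCs.trans (hYs.trans (List.suffix_append Y X)))
    · obtain ⟨C, hC, hCs⟩ := exists_square_suffix_of_border
        (List.prefix_of_prefix_length_le hYp hSp hlt.le)
        (List.suffix_of_suffix_length_le hYs hSX hlt.le) hlt hne.2
      exact hsq C hC (hCs.trans hSYX)
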